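/- arXiv:1103.5500 — 2 statements merged into one kernel-verified Lean document; each statement's English description precedes it below -/
import Mathlib

section
/- The ideal R𝔫 of R generated by 𝔫 is a prime ideal of R for every maximal ideal 𝔫 of R^{ℤ^n} if and only if the quotient group ℤ^{2n}/G is torsion-free, where G = {d ∈ ℤ^{2n} : u^d ∈ R^{ℤ^n}}. -/
namespace MTW

abbrev Exp (n : ℕ) : Type := (Fin n → ℤ) × (Fin n → ℤ)

abbrev LR (K : Type) [Field K] (n : ℕ) : Type := AddMonoidAlgebra K (Exp n)

noncomputable def mon (K : Type) [Field K] (n : ℕ) (d : Exp n) : LR K n :=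
  AddMonoidAlgebra.single d 1

noncomputable def U (K : Type) [Field K] (n : ℕ) (j : Fin n) : LR K n :=
  mon K n (Pi.single j 1, 0)

noncomputable def V (K : Type) [Field K] (n : ℕ) (j : Fin n) : LR K n :=
  mon K n (0, Pi.single j 1)

noncomputable def tElt (K : Type) [Field K] (n : ℕ) (k : ℤ) (r s : Fin n → Fin n → K)
    (i : Fin n) : LR K n :=
  (r i i ^ k - s i i ^ k)⁻¹ •
    (r i i ^ k • mon K n (Pi.single i k, 0) - s i i ^ k • mon K n (0, Pi.single i k))

noncomputable def sigmaZ (K : Type) [Field K] (n : ℕ)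
    (σ : Fin n → (LR K n ≃ₐ[K] LR K n)) (g : Fin n → ℤ) : LR K n ≃ₐ[K] LR K n :=
  (List.ofFn fun i => σ i ^ (g i)).prod

def IsInvariantIdeal (K : Type) [Field K] (n : ℕ)
    (σ : Fin n → (LR K n ≃ₐ[K] LR K n)) (J : Ideal (LR K n)) : Prop :=
  ∀ (g : Fin n → ℤ), ∀ x ∈ J, sigmaZ K n σ g x ∈ J

noncomputable def invariants (K : Type) [Field K] (n : ℕ)
    (σ : Fin n → (LR K n ≃ₐ[K] LR K n)) : Subalgebra K (LR K n) :=
  ⨅ i, AlgHom.equalizer (σ i).toAlgHom (AlgHom.id K (LR K n))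

section MonomialSubalgebra

variable {K M : Type*} [Field K] [AddCommGroup M]

theorem single_mem_of_mem {G : AddSubgroup M} {A : Subalgebra K (AddMonoidAlgebra K M)}
    (hA : ∀ a, a ∈ A ↔ ∀ d ∈ a.coeff.support, d ∈ G) {d : M} (hd : d ∈ G) (c : K) :
    AddMonoidAlgebra.single d c ∈ A := by
  rw [hA]
  intro e he
  rw [AddMonoidAlgebra.coeff_single] at he
  rwa [Finset.mem_singleton.1 (Finsupp.support_single_subset he)]

/-- Additive maps on a subalgebra spanned by monomials agree as soon as they agree on scalar
multiples of these monomials. -/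
theorem addHom_ext_of_single {B : Type*} [AddCommMonoid B] {G : AddSubgroup M}
    {A : Subalgebra K (AddMonoidAlgebra K M)}
    (hA : ∀ a, a ∈ A ↔ ∀ d ∈ a.coeff.support, d ∈ G) {f g : A →+ B}
    (hfg : ∀ (d : M) (hd : d ∈ G) (c : K),
      f ⟨AddMonoidAlgebra.single d c, single_mem_of_mem hA hd c⟩ =
        g ⟨AddMonoidAlgebra.single d c, single_mem_of_mem hA hd c⟩) : f = g := by
  ext a
  have ha : a = ∑ d ∈ a.1.coeff.support.attach,
      (⟨AddMonoidAlgebra.single d.1 (a.1.coeff d.1),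
        single_mem_of_mem hA ((hA a.1).1 a.2 d.1 d.2) _⟩ : A) := by
    apply Subtype.ext
    rw [AddSubmonoidClass.coe_finsetSum,
      Finset.sum_attach a.1.coeff.support fun d => AddMonoidAlgebra.single d (a.1.coeff d)]
    exact (AddMonoidAlgebra.sum_coeff_single a.1).symm
  rw [ha, map_sum, map_sum]
  exact Finset.sum_congr rfl fun d _ => hfg d.1 ((hA a.1).1 a.2 d.1 d.2) _

theorem uniqueSums_of_free (Q : Type*) [AddCommGroup Q] [Module.Free ℤ Q] : UniqueSums Q :=
  (Module.Free.chooseBasis ℤ Q).repr.toAddEquiv.uniqueSums_iff.2 inferInstance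

/-- If `M ⧸ G` is torsion-free, then `G` has a complement in `M`, so modulo the extension of a
maximal ideal `𝔫` of `K[G]` the algebra `K[M]` becomes the domain `(K[G] ⧸ 𝔫)[M ⧸ G]`. -/
theorem isPrime_map_of_torsionFree [Module.Finite ℤ M] (G : AddSubgroup M)
    (A : Subalgebra K (AddMonoidAlgebra K M))
    (hA : ∀ a, a ∈ A ↔ ∀ d ∈ a.coeff.support, d ∈ G)
    (hG : ∀ (d : M) (m : ℕ), 0 < m → m • d ∈ G → d ∈ G)
    (𝔫 : Ideal A) [𝔫.IsMaximal] : (Ideal.map A.val 𝔫).IsPrime := by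
  classical
  let N : Submodule ℤ M := G.toIntSubmodule
  have hN : ∀ d, d ∈ N ↔ d ∈ G := fun d => Iff.rfl
  have : Module.IsTorsionFree ℤ (M ⧸ N) := by
    refine .of_smul_eq_zero fun z q hzq => or_iff_not_imp_left.2 fun hz => ?_
    obtain ⟨d, rfl⟩ := N.mkQ_surjective q
    rw [← map_smul, Submodule.mkQ_apply, Submodule.Quotient.mk_eq_zero, hN] at hzq
    rw [Submodule.mkQ_apply, Submodule.Quotient.mk_eq_zero, hN]
    refine hG d z.natAbs (Int.natAbs_pos.2 hz) ?_
    rw [← natCast_zsmul]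
    rcases Int.natAbs_eq z with h | h
    · rwa [← h]
    · rw [h, neg_smul, neg_mem_iff] at hzq
      exact hzq
  have : UniqueSums (M ⧸ N) := uniqueSums_of_free _
  obtain ⟨s, hs⟩ := Module.projective_lifting_property N.mkQ (LinearMap.id : (M ⧸ N) →ₗ[ℤ] M ⧸ N)
    N.mkQ_surjective
  have hs' : ∀ d, d - s (N.mkQ d) ∈ G := fun d => by
    rw [← hN, ← Submodule.Quotient.mk_eq_zero, Submodule.Quotient.mk_sub, sub_eq_zero]
    exact (LinearMap.congr_fun hs (N.mkQ d)).symm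
  let part : M → A := fun d => ⟨AddMonoidAlgebra.single (d - s (N.mkQ d)) 1, single_mem_of_mem hA (hs' d) 1⟩
  let F : Multiplicative M →* AddMonoidAlgebra (A ⧸ 𝔫) (M ⧸ N) :=
    { toFun d := AddMonoidAlgebra.single (N.mkQ d.toAdd) (Ideal.Quotient.mk 𝔫 (part d.toAdd))
      map_one' := by
        have : part 0 = 1 := Subtype.ext (by simp [part, AddMonoidAlgebra.one_def])
        simp [this, AddMonoidAlgebra.one_def]
      map_mul' d e := by
        have : part (d.toAdd + e.toAdd) = part d.toAdd * part e.toAdd := Subtype.ext (by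
          simp only [part, MulMemClass.mk_mul_mk, AddMonoidAlgebra.single_mul_single, map_add,
            mul_one]
          congr 1
          abel)
        simp only [toAdd_mul, this, map_add, map_mul, AddMonoidAlgebra.single_mul_single] }
  let φ : AddMonoidAlgebra K M →ₐ[K] AddMonoidAlgebra (A ⧸ 𝔫) (M ⧸ N) :=
    AddMonoidAlgebra.lift K _ M F
  obtain ⟨J, hJ⟩ : ∃ J, J = Ideal.map A.val 𝔫 := ⟨_, rfl⟩
  let ι : A ⧸ 𝔫 →+* AddMonoidAlgebra K M ⧸ J :=
    Ideal.Quotient.lift 𝔫 ((Ideal.Quotient.mk J).comp (A.val : A →+* AddMonoidAlgebra K M))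
      fun a ha => Ideal.Quotient.eq_zero_iff_mem.2 (hJ ▸ Ideal.mem_map_of_mem A.val ha)
  let ψ : AddMonoidAlgebra (A ⧸ 𝔫) (M ⧸ N) →+* AddMonoidAlgebra K M ⧸ J :=
    AddMonoidAlgebra.liftNCRingHom ι
      ((Ideal.Quotient.mk J : AddMonoidAlgebra K M →* _).comp
        ((AddMonoidAlgebra.of K M).comp s.toAddMonoidHom.toMultiplicative))
      (fun _ _ => Commute.all _ _)
  have hψ : ∀ (q : M ⧸ N) (a : A), ψ (AddMonoidAlgebra.single q (Ideal.Quotient.mk 𝔫 a)) =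
      Ideal.Quotient.mk J (a.1 * AddMonoidAlgebra.single (s q) 1) := fun q a => by
    rw [map_mul]
    exact AddMonoidAlgebra.liftNCRingHom_single ι _ _ _ _
  have hφ : ∀ d c, φ (AddMonoidAlgebra.single d c) =
      c • AddMonoidAlgebra.single (N.mkQ d) (Ideal.Quotient.mk 𝔫 (part d)) := fun d c =>
    AddMonoidAlgebra.lift_single F d c
  have hsmul : ∀ (c : K) (q : M ⧸ N) (a : A),
      c • AddMonoidAlgebra.single q (Ideal.Quotient.mk 𝔫 a) =
        AddMonoidAlgebra.single q (Ideal.Quotient.mk 𝔫 (c • a)) := fun c q a => by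
    rw [AddMonoidAlgebra.smul_single]
    rfl
  have hψφ : ∀ x, ψ (φ x) = Ideal.Quotient.mk J x := fun x => by
    induction x using AddMonoidAlgebra.induction_linear with
    | zero => simp
    | add x y hx hy => rw [map_add, map_add, hx, hy, map_add]
    | single d c =>
      have hsplit : (c • part d).1 * AddMonoidAlgebra.single (s (N.mkQ d)) 1 =
          AddMonoidAlgebra.single d c := by
        simp [part, AddMonoidAlgebra.single_mul_single]
      rw [hφ, hsmul, hψ, hsplit]
  have hφA : ∀ a : A, φ a = AddMonoidAlgebra.single 0 (Ideal.Quotient.mk 𝔫 a) := fun a => by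
    refine DFunLike.congr_fun (addHom_ext_of_single hA
      (f := (AddMonoidHomClass.toAddMonoidHom φ).comp (A.val : A →+ AddMonoidAlgebra K M))
      (g := (AddMonoidAlgebra.singleAddHom (0 : M ⧸ N)).comp
        (Ideal.Quotient.mk 𝔫).toAddMonoidHom) fun d hd c => ?_) a
    have hd0 : N.mkQ d = 0 := (Submodule.Quotient.mk_eq_zero N).2 hd
    change φ (AddMonoidAlgebra.single d c) = AddMonoidAlgebra.single 0 (Ideal.Quotient.mk 𝔫 _)
    rw [hφ, hsmul, hd0]
    congr 2
    apply Subtype.ext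
    change c • AddMonoidAlgebra.single (d - s (N.mkQ d)) 1 = _
    rw [hd0, map_zero, sub_zero, AddMonoidAlgebra.smul_single, smul_eq_mul, mul_one]
  have hker : RingHom.ker φ = J := by
    apply le_antisymm
    · intro x hx
      rw [← Ideal.Quotient.eq_zero_iff_mem, ← hψφ, (RingHom.mem_ker).1 hx, map_zero]
    · rw [hJ, Ideal.map_le_iff_le_comap]
      intro a ha
      rw [Ideal.mem_comap, RingHom.mem_ker]
      exact (hφA a).trans
        (by rw [Ideal.Quotient.eq_zero_iff_mem.2 ha, AddMonoidAlgebra.single_zero])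
  rw [← hJ, ← hker]
  exact RingHom.ker_isPrime _

/-- If the extension to `K[M]` of the augmentation ideal of `K[G]` is prime, then `M ⧸ G` is
torsion-free. -/
theorem mem_of_isPrime_map (G : AddSubgroup M)
    (A : Subalgebra K (AddMonoidAlgebra K M))
    (hA : ∀ a, a ∈ A ↔ ∀ d ∈ a.coeff.support, d ∈ G)
    (h : ∀ 𝔫 : Ideal A, 𝔫.IsMaximal → (Ideal.map A.val 𝔫).IsPrime)
    (d : M) (m : ℕ) (hm : 0 < m) (hd : m • d ∈ G) : d ∈ G := by
  classical
  let ε : AddMonoidAlgebra K M →ₐ[K] K := AddMonoidAlgebra.lift K K M 1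
  have hε : ∀ d c, ε (AddMonoidAlgebra.single d c) = c := fun d c => by
    simp [ε, AddMonoidAlgebra.lift_single]
  let 𝔫 : Ideal A := RingHom.ker (ε.comp A.val)
  have hmax : 𝔫.IsMaximal := RingHom.ker_isMaximal_of_surjective _ fun c =>
    ⟨algebraMap K A c, by simp⟩
  let π : AddMonoidAlgebra K M →+* AddMonoidAlgebra K (M ⧸ G) :=
    AddMonoidAlgebra.mapDomainRingHom K (QuotientAddGroup.mk' G)
  have hπ : ∀ d c, π (AddMonoidAlgebra.single d c) = AddMonoidAlgebra.single (d : M ⧸ G) c :=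
    fun d c => AddMonoidAlgebra.mapDomain_single
  have hle : Ideal.map A.val 𝔫 ≤ RingHom.ker π := by
    rw [Ideal.map_le_iff_le_comap]
    intro a ha
    have h1 : π a = AddMonoidAlgebra.single 0 (ε a) :=
      DFunLike.congr_fun (addHom_ext_of_single hA
        (f := (π : AddMonoidAlgebra K M →+ _).comp (A.val : A →+ AddMonoidAlgebra K M))
        (g := ((AddMonoidAlgebra.singleAddHom (0 : M ⧸ G)).comp
          (ε : AddMonoidAlgebra K M →+ K)).comp (A.val : A →+ AddMonoidAlgebra K M))
        fun d hd c => by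
          have : (d : M ⧸ G) = 0 := (QuotientAddGroup.eq_zero_iff d).2 hd
          simp [hπ, hε, this]) a
    have h2 : ε a = 0 := ha
    rw [Ideal.mem_comap, RingHom.mem_ker]
    exact h1.trans (by rw [h2, AddMonoidAlgebra.single_zero])
  set q : M ⧸ G := (d : M ⧸ G)
  have hqm : m • q = 0 := (QuotientAddGroup.eq_zero_iff (m • d)).2 hd
  set o := addOrderOf q
  have hopos : 0 < o := (isOfFinAddOrder_iff_nsmul_eq_zero.2 ⟨m, hm, hqm⟩).addOrderOf_pos
  have hod : o • d ∈ G := (QuotientAddGroup.eq_zero_iff (o • d)).1 (addOrderOf_nsmul_eq_zero q)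
  let x : AddMonoidAlgebra K M := AddMonoidAlgebra.single d 1
  have hxp : ∀ i : ℕ, x ^ i = AddMonoidAlgebra.single (i • d) 1 := fun i => by
    simp [x, AddMonoidAlgebra.single_pow]
  have hmem : (∑ i ∈ Finset.range o, x ^ i) * (x - 1) ∈ Ideal.map A.val 𝔫 := by
    rw [geom_sum_mul, hxp]
    refine Ideal.mem_map_of_mem A.val (x := ⟨_, single_mem_of_mem hA hod 1⟩ - 1) ?_
    change ε (AddMonoidAlgebra.single (o • d) 1 - 1) = 0
    rw [map_sub, hε, map_one, sub_self]
  rcases (h 𝔫 hmax).mem_or_mem hmem with h1 | h1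
  · exfalso
    have h2 : π (∑ i ∈ Finset.range o, x ^ i) = 0 := hle h1
    have h3 := congrArg (fun y => y.coeff 0) h2
    simp only [map_sum, hxp, hπ, AddMonoidAlgebra.coeff_sum, Finsupp.finsetSum_apply,
      AddMonoidAlgebra.coeff_single] at h3
    rw [Finset.sum_eq_single 0] at h3
    · simp at h3
    · intro i hi hi0
      apply Finsupp.single_eq_of_ne'
      exact nsmul_ne_zero_of_lt_addOrderOf hi0 (Finset.mem_range.1 hi)
    · intro h0
      exact absurd (Finset.mem_range.2 hopos) h0
  · have h2 : π (x - 1) = 0 := hle h1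
    rw [map_sub, map_one, sub_eq_zero, hπ, AddMonoidAlgebra.one_def,
      AddMonoidAlgebra.single_left_inj one_ne_zero] at h2
    exact (QuotientAddGroup.eq_zero_iff d).1 h2

end MonomialSubalgebra

section Weights

variable {K : Type} [Field K] {n : ℕ}

theorem mon_add (d e : Exp n) : mon K n (d + e) = mon K n d * mon K n e := by
  simp [mon, AddMonoidAlgebra.single_mul_single]

theorem mon_zero : mon K n 0 = 1 := rfl

theorem mon_ne_zero (d : Exp n) : mon K n d ≠ 0 := by
  simp [mon]

theorem mem_invariants {σ : Fin n → (LR K n ≃ₐ[K] LR K n)} {a : LR K n} :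
    a ∈ invariants K n σ ↔ ∀ i, σ i a = a := by
  simp [invariants, Algebra.mem_iInf]

/-- The exponents whose monomials are eigenvectors of an automorphism. -/
noncomputable def eigenExponents (τ : LR K n ≃ₐ[K] LR K n) : AddSubgroup (Exp n) where
  carrier := {d | ∃ c : K, τ (mon K n d) = c • mon K n d}
  zero_mem' := ⟨1, by simp [mon_zero]⟩
  add_mem' := by
    rintro d e ⟨b, hb⟩ ⟨c, hc⟩
    exact ⟨b * c, by rw [mon_add, map_mul, hb, hc, smul_mul_smul_comm]⟩
  neg_mem' := by
    rintro d ⟨c, hc⟩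
    have hc0 : c ≠ 0 := by
      rintro rfl
      rw [zero_smul, EmbeddingLike.map_eq_zero_iff] at hc
      exact mon_ne_zero d hc
    have h1 : mon K n d * mon K n (-d) = 1 := by rw [← mon_add, add_neg_cancel, mon_zero]
    have h2 : c • mon K n d * τ (mon K n (-d)) = 1 := by rw [← hc, ← map_mul, h1, map_one]
    refine ⟨c⁻¹, ?_⟩
    rw [eq_inv_smul_iff₀ hc0]
    calc c • τ (mon K n (-d)) = mon K n d * mon K n (-d) * (c • τ (mon K n (-d))) := by
          rw [h1, one_mul]
      _ = mon K n (-d) * (c • mon K n d * τ (mon K n (-d))) := by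
          simp only [mul_smul_comm, smul_mul_assoc]; congr 1; ring
      _ = mon K n (-d) := by rw [h2, mul_one]

theorem eigenExponents_eq_top {τ : LR K n ≃ₐ[K] LR K n}
    (hU : ∀ j, ∃ c : K, τ (U K n j) = c • U K n j)
    (hV : ∀ j, ∃ c : K, τ (V K n j) = c • V K n j) : eigenExponents τ = ⊤ := by
  rw [eq_top_iff]
  intro d _
  have hd : d = ∑ j, d.1 j • ((Pi.single j 1, 0) : Exp n) +
      ∑ j, d.2 j • ((0, Pi.single j 1) : Exp n) := by
    ext j <;> simp [Prod.fst_sum, Prod.snd_sum, Finset.sum_apply, Pi.single_apply]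
  rw [hd]
  exact add_mem (sum_mem fun j _ => zsmul_mem (hU j) _) (sum_mem fun j _ => zsmul_mem (hV j) _)

/-- The exponents of the invariant monomials. -/
noncomputable def invariantExponents (σ : Fin n → (LR K n ≃ₐ[K] LR K n)) :
    AddSubgroup (Exp n) where
  carrier := {d | mon K n d ∈ invariants K n σ}
  zero_mem' := one_mem (invariants K n σ)
  add_mem' {d e} hd he := by
    simp only [Set.mem_ofPred_eq, mon_add] at *
    exact mul_mem hd he
  neg_mem' {d} hd := by
    simp only [Set.mem_ofPred_eq, mem_invariants] at *
    intro i
    have h1 : mon K n d * mon K n (-d) = 1 := by rw [← mon_add, add_neg_cancel, mon_zero]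
    have h2 : mon K n d * σ i (mon K n (-d)) = 1 := by
      nth_rewrite 1 [← hd i]
      rw [← map_mul, h1, map_one]
    exact (left_inv_eq_right_inv (by rw [mul_comm, h1]) h2).symm

theorem mem_invariants_iff_support {σ : Fin n → (LR K n ≃ₐ[K] LR K n)}
    (hσ : ∀ i, eigenExponents (σ i) = ⊤) (a : LR K n) :
    a ∈ invariants K n σ ↔ ∀ d ∈ a.coeff.support, d ∈ invariantExponents σ := by
  constructor
  · intro ha d hd
    have hex : ∀ i d, ∃ c : K, σ i (mon K n d) = c • mon K n d := fun i d => by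
      have : d ∈ eigenExponents (σ i) := hσ i ▸ AddSubgroup.mem_top d
      exact this
    choose c hc using hex
    change mon K n d ∈ invariants K n σ
    rw [mem_invariants] at ha ⊢
    intro i
    have hcoeff : (σ i a).coeff d = c i d * a.coeff d := by
      clear ha hd
      induction a using AddMonoidAlgebra.induction_linear with
      | zero => simp
      | add x y hx hy => simp [hx, hy, mul_add]
      | single e b =>
        have : AddMonoidAlgebra.single e b = b • mon K n e := by simp [mon]
        rw [this, map_smul, hc]
        by_cases hed : e = d
        · subst hed; simp [mon, mul_comm]
        · simp [mon, hed]
    rw [ha i] at hcoeff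
    rw [hc, (mul_eq_right₀ (Finsupp.mem_support_iff.1 hd)).1 hcoeff.symm, one_smul]
  · intro h
    rw [← AddMonoidAlgebra.sum_coeff_single a, Finsupp.sum]
    refine sum_mem fun d hd => ?_
    have : AddMonoidAlgebra.single d (a.coeff d) = a.coeff d • mon K n d := by simp [mon]
    rw [this]
    exact Subalgebra.smul_mem _ (h d hd) _

end Weights

/-- `R𝔫` is a prime ideal of `R` for every maximal ideal `𝔫` of
`R^{ℤ^n}` if and only if `ℤ^{2n}/G` is torsion-free, where
`G = {d ∈ ℤ^{2n} : u^d ∈ R^{ℤ^n}}` (torsion-freeness of the quotient expressed as: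
`m • d ∈ G` for some `m > 0` implies `d ∈ G`). -/
theorem statement6
    (K : Type) [Field K] (n : ℕ) (hn : 0 < n)
    (k : ℤ) (hk : k ≠ 0) (r s : Fin n → Fin n → K)
    (hr : ∀ i j, r i j ≠ 0) (hs : ∀ i j, s i j ≠ 0)
    (hroot : ∀ i, ∀ m : ℕ, 0 < m → (r i i / s i i) ^ m ≠ 1)
    (hrs : ∀ i j, i ≠ j → r i j ^ k = s i j ^ k)
    (σ : Fin n → (LR K n ≃ₐ[K] LR K n))
    (hσu : ∀ i j, σ i (U K n j) = (r i j)⁻¹ • U K n j)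
    (hσv : ∀ i j, σ i (V K n j) = (s i j)⁻¹ • V K n j)
    :
    (∀ 𝔫 : Ideal (invariants K n σ), 𝔫.IsMaximal →
        (Ideal.map (invariants K n σ).val 𝔫).IsPrime) ↔
      (∀ (d : Exp n) (m : ℕ), 0 < m →
        mon K n (m • d) ∈ invariants K n σ → mon K n d ∈ invariants K n σ) := by
  have hσ : ∀ i, eigenExponents (σ i) = ⊤ := fun i =>
    eigenExponents_eq_top (fun j => ⟨_, hσu i j⟩) (fun j => ⟨_, hσv i j⟩)
  have hA := mem_invariants_iff_support hσ
  exact ⟨mem_of_isPrime_map (invariantExponents σ) _ hA,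
    fun hG 𝔫 _ => isPrime_map_of_torsionFree (invariantExponents σ) _ hA hG 𝔫⟩

end MTW
end

section
/- The multiparameter twisted Weyl datum satisfies the consistency relations: σ_iσ_j(t_i t_j) = μ_{ij}μ_{ji} σ_i(t_i)σ_j(t_j) holds in R for all i ≠ j, and t_j σ_iσ_k(t_j) = σ_i(t_j)σ_k(t_j) holds in R for all pairwise distinct i, j, k. -/
namespace MTW

theorem mon_nsmul (K : Type) [Field K] (n : ℕ) (d : Exp n) (m : ℕ) :
    mon K n (m • d) = mon K n d ^ m := by
  simp [mon, AddMonoidAlgebra.single_pow]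

theorem mon_mul_mon_neg (K : Type) [Field K] (n : ℕ) (d : Exp n) :
    mon K n d * mon K n (-d) = 1 := by
  simp [mon, AddMonoidAlgebra.single_mul_single, AddMonoidAlgebra.one_def]

/-- An algebra endomorphism that scales a Laurent monomial scales all its integer powers. -/
theorem map_mon_zsmul {K : Type} [Field K] {n : ℕ} (φ : LR K n ≃ₐ[K] LR K n) {d : Exp n} {c : K}
    (hc : c ≠ 0) (h : φ (mon K n d) = c • mon K n d) (m : ℤ) :
    φ (mon K n (m • d)) = c ^ m • mon K n (m • d) := by
  have hnat (m : ℕ) : φ (mon K n (m • d)) = c ^ m • mon K n (m • d) := by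
    rw [mon_nsmul, map_pow, h, smul_pow]
  obtain ⟨m, rfl | rfl⟩ := m.eq_nat_or_neg
  · simpa using hnat m
  · rw [neg_smul, natCast_zsmul, zpow_neg, zpow_natCast]
    have hφ : c ^ m • (mon K n (m • d) * φ (mon K n (-(m • d)))) = 1 := by
      rw [← smul_mul_assoc, ← hnat, ← map_mul, mon_mul_mon_neg, map_one]
    calc φ (mon K n (-(m • d)))
        = (c ^ m)⁻¹ • (mon K n (-(m • d)) *
            (c ^ m • (mon K n (m • d) * φ (mon K n (-(m • d)))))) := by
          rw [mul_smul_comm, inv_smul_smul₀ (pow_ne_zero m hc), ← mul_assoc,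
            mul_comm (mon K n (-(m • d))), mon_mul_mon_neg, one_mul]
      _ = (c ^ m)⁻¹ • mon K n (-(m • d)) := by rw [hφ, mul_one]

/-- The multiparameter twisted Weyl datum satisfies the consistency
relations: with `μ_{ij} = r_{ji}^{-k} λ_{ji}`,
`σ_iσ_j(t_i t_j) = μ_{ij}μ_{ji} σ_i(t_i)σ_j(t_j)` for all `i ≠ j`, and
`t_j σ_iσ_l(t_j) = σ_i(t_j)σ_l(t_j)` for all pairwise distinct `i, j, l`. -/
theorem statement11
    (K : Type) [Field K] (n : ℕ) (hn : 0 < n)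
    (k : ℤ) (hk : k ≠ 0) (r s : Fin n → Fin n → K)
    (hr : ∀ i j, r i j ≠ 0) (hs : ∀ i j, s i j ≠ 0)
    (hroot : ∀ i, ∀ m : ℕ, 0 < m → (r i i / s i i) ^ m ≠ 1)
    (hrs : ∀ i j, i ≠ j → r i j ^ k = s i j ^ k)
    (σ : Fin n → (LR K n ≃ₐ[K] LR K n))
    (hσu : ∀ i j, σ i (U K n j) = (r i j)⁻¹ • U K n j)
    (hσv : ∀ i j, σ i (V K n j) = (s i j)⁻¹ • V K n j)
    (Λ : Fin n → Fin n → K) (hΛ0 : ∀ i j, Λ i j ≠ 0)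
    (hΛ1 : ∀ i, Λ i i = 1) (hΛ2 : ∀ i j, i ≠ j → Λ i j * Λ j i = 1) :
    (∀ i j, i ≠ j →
      σ i (σ j (tElt K n k r s i * tElt K n k r s j)) =
        ((r j i ^ (-k) * Λ j i) * (r i j ^ (-k) * Λ i j)) •
          (σ i (tElt K n k r s i) * σ j (tElt K n k r s j))) ∧
    (∀ i j l, i ≠ j → j ≠ l → i ≠ l →
      tElt K n k r s j * σ i (σ l (tElt K n k r s j)) =
        σ i (tElt K n k r s j) * σ l (tElt K n k r s j)) := by
  have hu (i j : Fin n) : σ i (mon K n (Pi.single j k, 0)) =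
      (r i j ^ k)⁻¹ • mon K n (Pi.single j k, 0) := by
    have h := map_mon_zsmul (σ i) (inv_ne_zero (hr i j)) (hσu i j) k
    simpa [Prod.smul_mk, ← Pi.single_smul] using h
  have hv (i j : Fin n) : σ i (mon K n (0, Pi.single j k)) =
      (s i j ^ k)⁻¹ • mon K n (0, Pi.single j k) := by
    have h := map_mon_zsmul (σ i) (inv_ne_zero (hs i j)) (hσv i j) k
    simpa [Prod.smul_mk, ← Pi.single_smul] using h
  have ht (i j : Fin n) (hij : i ≠ j) :
      σ i (tElt K n k r s j) = (r i j ^ k)⁻¹ • tElt K n k r s j := by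
    simp only [tElt, map_smul, map_sub, hu, hv, ← hrs i j hij]
    module
  have hσt (i j : Fin n) (hij : i ≠ j) :
      σ i (σ j (tElt K n k r s j)) = (r i j ^ k)⁻¹ • σ j (tElt K n k r s j) := by
    simp only [tElt, map_smul, map_sub, hu, hv, ← hrs i j hij]
    module
  refine ⟨fun i j hij => ?_, fun i j l hij hjl _ => ?_⟩
  · rw [map_mul, map_mul, ht j i hij.symm, map_smul, hσt i j hij, smul_mul_smul_comm]
    congr 1
    rw [zpow_neg, zpow_neg, mul_mul_mul_comm, mul_comm (Λ j i), hΛ2 i j hij, mul_one]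
  · rw [ht l j hjl.symm, map_smul, ht i j hij, smul_smul, mul_smul_comm, smul_mul_smul_comm,
      mul_comm (r l j ^ k)⁻¹]

end MTW
end
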